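/- Let f(x, W) = f̃(W₁x, W₂) with f̃ : ℝ^m × ℝ^p → ℝ differentiable, let x₁, …, xₙ ∈ ℝ^d be nonzero points, and let k ≥ 1 be an integer. Then the discrete Sobolev seminorm satisfies |f(·, W)|_{1,2k,{xᵢ}} ≤ (‖W₁ᵀ‖_{2k} / min_{1≤i≤n} ‖xᵢ‖_{2k}) · ((1/n) Σᵢ₌₁ⁿ ‖∇_W f(xᵢ, W)‖_{2k}^{2k})^{1/(2k)}. -/

import Mathlib

/-- Matrix–vector product of `W : ℝ^{m×d}` (as a function) with `x : ℝ^d`. -/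
noncomputable def mVec {m d : ℕ} (W : Fin m → Fin d → ℝ) (x : Fin d → ℝ) : Fin m → ℝ :=
  fun r => ∑ s, W r s * x s

/-- ℓ^{2k} norm of a vector. -/
noncomputable def lpnorm (k : ℕ) {d : ℕ} (v : Fin d → ℝ) : ℝ :=
  (∑ j, |v j| ^ (2 * k)) ^ ((2 * k : ℝ))⁻¹

/-- Operator norm of a matrix induced by ℓ^{2k} norms on domain and codomain. -/
noncomputable def opNormP (k : ℕ) {m d : ℕ} (W : Fin m → Fin d → ℝ) : ℝ :=
  sSup {r : ℝ | ∃ x : Fin d → ℝ, lpnorm k x = 1 ∧ r = lpnorm k (mVec W x)}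

/-- `‖∇_W f‖_{2k}^{2k}`: the `2k`-th power of the ℓ^{2k} norm of the gradient of
`F : (W₁, W₂) ↦ ℝ` with respect to all (flattened) parameters. -/
noncomputable def gradW2kPow {m d p : ℕ} (k : ℕ)
    (F : ((Fin m → Fin d → ℝ) × (Fin p → ℝ)) → ℝ)
    (W : (Fin m → Fin d → ℝ) × (Fin p → ℝ)) : ℝ :=
  (∑ r, ∑ s, |fderiv ℝ F W (Pi.single r (Pi.single s 1), 0)| ^ (2 * k))
    + ∑ l, |fderiv ℝ F W (0, Pi.single l 1)| ^ (2 * k)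

theorem lpnorm_nonneg (k : ℕ) {d : ℕ} (v : Fin d → ℝ) : 0 ≤ lpnorm k v := by
  unfold lpnorm; positivity

theorem lpnorm_pow {k : ℕ} (hk : 1 ≤ k) {d : ℕ} (v : Fin d → ℝ) :
    lpnorm k v ^ (2 * k) = ∑ j, |v j| ^ (2 * k) := by
  have h := Real.rpow_inv_natCast_pow (x := ∑ j, |v j| ^ (2 * k)) (by positivity)
    (n := 2 * k) (by omega)
  push_cast at h
  exact h

theorem lpnorm_smul {k : ℕ} (hk : 1 ≤ k) {d : ℕ} (c : ℝ) (v : Fin d → ℝ) :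
    lpnorm k (c • v) = |c| * lpnorm k v := by
  refine (pow_left_inj₀ (lpnorm_nonneg k _)
    (mul_nonneg (abs_nonneg c) (lpnorm_nonneg k v)) (n := 2 * k) (by omega)).1 ?_
  rw [mul_pow, lpnorm_pow hk, lpnorm_pow hk, Finset.mul_sum]
  simp [abs_mul, mul_pow]

theorem abs_le_lpnorm {k : ℕ} (hk : 1 ≤ k) {d : ℕ} (v : Fin d → ℝ) (j : Fin d) :
    |v j| ≤ lpnorm k v := by
  refine le_of_pow_le_pow_left₀ (n := 2 * k) (by omega) (lpnorm_nonneg k v) ?_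
  rw [lpnorm_pow hk]
  exact Finset.single_le_sum (f := fun j => |v j| ^ (2 * k))
    (fun _ _ => by positivity) (Finset.mem_univ j)

theorem lpnorm_pos {k : ℕ} (hk : 1 ≤ k) {d : ℕ} {v : Fin d → ℝ} (hv : v ≠ 0) :
    0 < lpnorm k v := by
  obtain ⟨j, hj⟩ := Function.ne_iff.1 hv
  exact (abs_pos.2 hj).trans_le (abs_le_lpnorm hk v j)

theorem lpnorm_mono (k : ℕ) {d : ℕ} {v w : Fin d → ℝ} (h : ∀ j, |v j| ≤ |w j|) :
    lpnorm k v ≤ lpnorm k w := by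
  unfold lpnorm
  exact Real.rpow_le_rpow (by positivity) (Finset.sum_le_sum fun j _ =>
    pow_le_pow_left₀ (abs_nonneg _) (h j) _) (by positivity)

theorem mVec_smul {m d : ℕ} (A : Fin m → Fin d → ℝ) (c : ℝ) (v : Fin d → ℝ) :
    mVec A (c • v) = c • mVec A v := by
  ext r
  simp only [mVec, Pi.smul_apply, smul_eq_mul, Finset.mul_sum]
  exact Finset.sum_congr rfl fun _ _ => by ring

theorem opNormP_nonneg (k : ℕ) {m d : ℕ} (A : Fin m → Fin d → ℝ) : 0 ≤ opNormP k A := by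
  refine Real.sSup_nonneg ?_
  rintro r ⟨v, -, rfl⟩
  exact lpnorm_nonneg k _

theorem bddAbove_lpnorm_mVec {k : ℕ} (hk : 1 ≤ k) {m d : ℕ} (A : Fin m → Fin d → ℝ) :
    BddAbove {r : ℝ | ∃ x : Fin d → ℝ, lpnorm k x = 1 ∧ r = lpnorm k (mVec A x)} := by
  refine ⟨lpnorm k fun r => ∑ s, |A r s|, ?_⟩
  rintro _ ⟨v, hv, rfl⟩
  refine lpnorm_mono k fun r => ?_
  rw [abs_of_nonneg (Finset.sum_nonneg fun s _ => abs_nonneg (A r s))]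
  refine (Finset.abs_sum_le_sum_abs _ _).trans (Finset.sum_le_sum fun s _ => ?_)
  rw [abs_mul]
  exact mul_le_of_le_one_right (abs_nonneg _) (hv ▸ abs_le_lpnorm hk v s)

theorem lpnorm_mVec_le {k : ℕ} (hk : 1 ≤ k) {m d : ℕ} (A : Fin m → Fin d → ℝ)
    (v : Fin d → ℝ) : lpnorm k (mVec A v) ≤ opNormP k A * lpnorm k v := by
  rcases eq_or_ne v 0 with rfl | hv
  · have h : mVec A 0 = (0 : ℝ) • mVec A 0 := by rw [← mVec_smul, smul_zero]
    rw [h, lpnorm_smul hk, abs_zero, zero_mul]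
    exact mul_nonneg (opNormP_nonneg k A) (lpnorm_nonneg k _)
  · have hpos := lpnorm_pos hk hv
    have h : lpnorm k (mVec A ((lpnorm k v)⁻¹ • v)) ≤ opNormP k A := by
      refine le_csSup (bddAbove_lpnorm_mVec hk A) ⟨_, ?_, rfl⟩
      rw [lpnorm_smul hk, abs_of_pos (inv_pos.2 hpos), inv_mul_cancel₀ hpos.ne']
    rwa [mVec_smul, lpnorm_smul hk, abs_of_pos (inv_pos.2 hpos), inv_mul_le_iff₀ hpos,
      mul_comm] at h

/-- `mVec` as a continuous linear map in the vector. -/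
noncomputable def mVecCLM {m d : ℕ} (A : Fin m → Fin d → ℝ) :
    (Fin d → ℝ) →L[ℝ] (Fin m → ℝ) :=
  ContinuousLinearMap.pi fun r => ∑ s, A r s • ContinuousLinearMap.proj s

theorem mVecCLM_apply {m d : ℕ} (A : Fin m → Fin d → ℝ) (z : Fin d → ℝ) :
    mVecCLM A z = mVec A z := by
  ext r
  simp [mVecCLM, mVec]

/-- `mVec` as a continuous linear map in the matrix. -/
noncomputable def mVecFlipCLM (m : ℕ) {d : ℕ} (z : Fin d → ℝ) :
    (Fin m → Fin d → ℝ) →L[ℝ] (Fin m → ℝ) :=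
  ContinuousLinearMap.pi fun r => ∑ s, z s •
    (ContinuousLinearMap.proj (R := ℝ) (φ := fun _ : Fin d => ℝ) s).comp
      (ContinuousLinearMap.proj (R := ℝ) (φ := fun _ : Fin m => Fin d → ℝ) r)

theorem mVecFlipCLM_apply {m d : ℕ} (A : Fin m → Fin d → ℝ) (z : Fin d → ℝ) :
    mVecFlipCLM m z A = mVec A z := by
  ext r
  simp [mVecFlipCLM, mVec, mul_comm]

section ChainRule

variable {m d p : ℕ} {ft : (Fin m → ℝ) → (Fin p → ℝ) → ℝ}

/-- The partial gradient of `ft` in its first argument. -/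
noncomputable def gradFst (ft : (Fin m → ℝ) → (Fin p → ℝ) → ℝ)
    (q : (Fin m → ℝ) × (Fin p → ℝ)) : Fin m → ℝ :=
  fun r => fderiv ℝ (fun q : (Fin m → ℝ) × (Fin p → ℝ) => ft q.1 q.2) q (Pi.single r 1, 0)

theorem fderiv_apply_fst (ft : (Fin m → ℝ) → (Fin p → ℝ) → ℝ)
    (q : (Fin m → ℝ) × (Fin p → ℝ)) (v : Fin m → ℝ) :
    fderiv ℝ (fun q : (Fin m → ℝ) × (Fin p → ℝ) => ft q.1 q.2) q (v, 0)
      = ∑ r, v r * gradFst ft q r := by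
  have h : (v, (0 : Fin p → ℝ)) =
      ∑ r, v r • ((Pi.single r 1, 0) : (Fin m → ℝ) × (Fin p → ℝ)) := by
    ext j <;> simp [Prod.fst_sum, Prod.snd_sum, Finset.sum_apply, Pi.single_apply]
  rw [h, map_sum]
  simp only [map_smul, smul_eq_mul, gradFst]

theorem fderiv_input_single
    (hft : Differentiable ℝ (fun q : (Fin m → ℝ) × (Fin p → ℝ) => ft q.1 q.2))
    (W : (Fin m → Fin d → ℝ) × (Fin p → ℝ)) (z : Fin d → ℝ) (j : Fin d) :
    fderiv ℝ (fun z => ft (mVec W.1 z) W.2) z (Pi.single j 1)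
      = mVec (fun s r => W.1 r s) (gradFst ft (mVec W.1 z, W.2)) j := by
  have hin : HasFDerivAt (fun z => (mVec W.1 z, W.2))
      ((mVecCLM W.1).prod (0 : (Fin d → ℝ) →L[ℝ] (Fin p → ℝ))) z := by
    refine HasFDerivAt.prodMk ?_ (hasFDerivAt_const _ _)
    exact (mVecCLM W.1).hasFDerivAt.congr_of_eventuallyEq
      (.of_forall fun z => (mVecCLM_apply W.1 z).symm)
  have h := (hft (mVec W.1 z, W.2)).hasFDerivAt.comp z hin
  have h' := h.fderiv
  simp only [Function.comp_def] at h'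
  rw [h', ContinuousLinearMap.comp_apply, ContinuousLinearMap.prod_apply,
    zero_apply, fderiv_apply_fst, mVecCLM_apply]
  simp [mVec, Pi.single_apply]

theorem fderiv_param_single
    (hft : Differentiable ℝ (fun q : (Fin m → ℝ) × (Fin p → ℝ) => ft q.1 q.2))
    (W : (Fin m → Fin d → ℝ) × (Fin p → ℝ)) (z : Fin d → ℝ) (r : Fin m) (s : Fin d) :
    fderiv ℝ (fun V : (Fin m → Fin d → ℝ) × (Fin p → ℝ) => ft (mVec V.1 z) V.2) W
        (Pi.single r (Pi.single s 1), 0)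
      = z s * gradFst ft (mVec W.1 z, W.2) r := by
  have hin : HasFDerivAt
      (fun V : (Fin m → Fin d → ℝ) × (Fin p → ℝ) => (mVec V.1 z, V.2))
      (((mVecFlipCLM m z).comp (ContinuousLinearMap.fst ℝ _ _)).prod
        (ContinuousLinearMap.snd ℝ _ _)) W := by
    refine HasFDerivAt.prodMk ?_ hasFDerivAt_snd
    simpa [mVecFlipCLM_apply] using
      ((mVecFlipCLM m z).comp (ContinuousLinearMap.fst ℝ _ (Fin p → ℝ))).hasFDerivAt (x := W)
  have h := (hft (mVec W.1 z, W.2)).hasFDerivAt.comp W hin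
  have h' := h.fderiv
  simp only [Function.comp_def] at h'
  have hv : mVec (Pi.single r (Pi.single s 1)) z = Pi.single r (z s) := by
    ext t
    by_cases ht : t = r
    · subst ht; simp [mVec, Pi.single_apply]
    · simp [mVec, ht]
  rw [h', ContinuousLinearMap.comp_apply, ContinuousLinearMap.prod_apply,
    ContinuousLinearMap.comp_apply, ContinuousLinearMap.coe_fst', ContinuousLinearMap.coe_snd',
    fderiv_apply_fst, mVecFlipCLM_apply, hv]
  simp [Pi.single_apply]

theorem lpnorm_pow_mul_gradFst_le {k : ℕ} (hk : 1 ≤ k)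
    (hft : Differentiable ℝ (fun q : (Fin m → ℝ) × (Fin p → ℝ) => ft q.1 q.2))
    (W : (Fin m → Fin d → ℝ) × (Fin p → ℝ)) (z : Fin d → ℝ) :
    (lpnorm k z * lpnorm k (gradFst ft (mVec W.1 z, W.2))) ^ (2 * k)
      ≤ gradW2kPow k (fun V => ft (mVec V.1 z) V.2) W := by
  unfold gradW2kPow
  refine le_add_of_le_of_nonneg (le_of_eq ?_) (by positivity)
  simp only [fderiv_param_single hft, abs_mul, mul_pow, ← Finset.sum_mul, ← Finset.mul_sum]
  rw [lpnorm_pow hk, lpnorm_pow hk]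

end ChainRule

/-- the discrete Sobolev seminorm of `f(·, W)` on the training set is bounded by
`(‖W₁ᵀ‖_{2k}/minᵢ‖xᵢ‖_{2k}) · ((1/n) Σᵢ ‖∇_W f(xᵢ, W)‖_{2k}^{2k})^{1/(2k)}`. -/
theorem discrete_sobolev_seminorm_bound
    {m d p n : ℕ} (hn : 0 < n) (k : ℕ) (hk : 1 ≤ k)
    (ft : (Fin m → ℝ) → (Fin p → ℝ) → ℝ)
    (hft : Differentiable ℝ (fun q : (Fin m → ℝ) × (Fin p → ℝ) => ft q.1 q.2))
    (W : (Fin m → Fin d → ℝ) × (Fin p → ℝ))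
    (x : Fin n → Fin d → ℝ) (hx : ∀ i, x i ≠ 0) :
    ((1 / (n : ℝ)) * ∑ i, ∑ j,
        |fderiv ℝ (fun z => ft (mVec W.1 z) W.2) (x i) (Pi.single j 1)| ^ (2 * k))
          ^ ((2 * k : ℝ))⁻¹
      ≤ (opNormP k (fun s r => W.1 r s) /
          Finset.univ.inf' ⟨⟨0, hn⟩, Finset.mem_univ _⟩ (fun i => lpnorm k (x i))) *
        ((1 / (n : ℝ)) * ∑ i,
            gradW2kPow k (fun V => ft (mVec V.1 (x i)) V.2) W) ^ ((2 * k : ℝ))⁻¹ := by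
  set M := Finset.univ.inf' ⟨⟨0, hn⟩, Finset.mem_univ _⟩ (fun i => lpnorm k (x i))
  set A := fun s r => W.1 r s
  have hM : 0 < M := (Finset.lt_inf'_iff _).2 fun i _ => lpnorm_pos hk (hx i)
  have hc : 0 ≤ opNormP k A / M := div_nonneg (opNormP_nonneg k A) hM.le
  have key : ∀ i, ∑ j,
        |fderiv ℝ (fun z => ft (mVec W.1 z) W.2) (x i) (Pi.single j 1)| ^ (2 * k)
      ≤ (opNormP k A / M) ^ (2 * k) * gradW2kPow k (fun V => ft (mVec V.1 (x i)) V.2) W := by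
    intro i
    set g := gradFst ft (mVec W.1 (x i), W.2) with hg
    have hMi : M ≤ lpnorm k (x i) := Finset.inf'_le _ (Finset.mem_univ i)
    calc _ = lpnorm k (mVec A g) ^ (2 * k) := by
          rw [lpnorm_pow hk]; simp only [fderiv_input_single hft, hg, A]
      _ ≤ (opNormP k A / M * (lpnorm k (x i) * lpnorm k g)) ^ (2 * k) := by
          refine pow_le_pow_left₀ (lpnorm_nonneg k _) ((lpnorm_mVec_le hk A g).trans ?_) _
          calc opNormP k A * lpnorm k g = opNormP k A / M * (M * lpnorm k g) := by
                field_simp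
            _ ≤ _ := mul_le_mul_of_nonneg_left
                (mul_le_mul_of_nonneg_right hMi (lpnorm_nonneg k g)) hc
      _ ≤ _ := by
          rw [mul_pow]
          exact mul_le_mul_of_nonneg_left (lpnorm_pow_mul_gradFst_le hk hft W (x i))
            (pow_nonneg hc _)
  have hS : 0 ≤ 1 / (n : ℝ) * ∑ i, gradW2kPow k (fun V => ft (mVec V.1 (x i)) V.2) W := by
    unfold gradW2kPow; positivity
  have hroot : ((opNormP k A / M) ^ (2 * k)) ^ ((2 * k : ℝ))⁻¹ = opNormP k A / M := by
    have h := Real.pow_rpow_inv_natCast hc (n := 2 * k) (by omega)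
    push_cast at h
    exact h
  calc _ ≤ ((opNormP k A / M) ^ (2 * k) * (1 / (n : ℝ) *
        ∑ i, gradW2kPow k (fun V => ft (mVec V.1 (x i)) V.2) W)) ^ ((2 * k : ℝ))⁻¹ := by
        refine Real.rpow_le_rpow (by positivity) ?_ (by positivity)
        rw [mul_left_comm, Finset.mul_sum _ _ ((opNormP k A / M) ^ (2 * k))]
        exact mul_le_mul_of_nonneg_left (Finset.sum_le_sum fun i _ => key i) (by positivity)
    _ = _ := by rw [Real.mul_rpow (pow_nonneg hc _) hS, hroot]
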